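/- arXiv:1202.1335 — 2 statements merged into one kernel-verified Lean document; each statement's English description precedes it below -/
import Mathlib

section
/- Let 0 < R ≤ 1, let f be an analytic function without zeros on the disk |z| < R, and let (ε_n) be a sequence with ε_n ∈ {1,−1}. Then there exists a unique sequence (α_n) of complex numbers such that the partial products f(0)·∏_{n=1}^{N} (1+ε_n z^n)^{α_n} converge compactly to f on the disk |z| < R as N → ∞. -/
open Filter Topology Finset


lemma aux_log (R : ℝ) (hR0 : 0 < R)
    (f : ℂ → ℂ) (hf : AnalyticOnNhd ℂ f (Metric.ball (0 : ℂ) R))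
    (hfne : ∀ z ∈ Metric.ball (0 : ℂ) R, f z ≠ 0) :
    ∃ g : ℂ → ℂ, DifferentiableOn ℂ g (Metric.ball 0 R) ∧ g 0 = 0 ∧
      ∀ z ∈ Metric.ball (0 : ℂ) R, f z = f 0 * Complex.exp (g z) := by
  have h0 : (0 : ℂ) ∈ Metric.ball (0 : ℂ) R := by simpa using hR0
  have hd : DifferentiableOn ℂ (fun z => deriv f z / f z) (Metric.ball (0 : ℂ) R) :=
    hf.deriv.differentiableOn.div hf.differentiableOn hfne
  obtain ⟨g, hg0, hg⟩ := hd.isExactOn_ball.with_val_at 0 0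
  refine ⟨g, fun z hz => (hg z hz).differentiableAt.differentiableWithinAt, hg0, ?_⟩
  have key : ∀ z ∈ Metric.ball (0 : ℂ) R,
      HasDerivAt (fun z => f z * Complex.exp (-g z)) 0 z := by
    intro z hz
    have h1 := (hf z hz).differentiableAt.hasDerivAt
    have h2 := h1.mul (hg z hz).neg.cexp
    refine h2.congr_deriv ?_
    have := hfne z hz
    simp only [Pi.neg_apply]
    field_simp
    ring
  have hconst : ∀ {x y : ℂ}, x ∈ Metric.ball (0 : ℂ) R → y ∈ Metric.ball (0 : ℂ) R →
      f x * Complex.exp (-g x) = f y * Complex.exp (-g y) := Metric.isOpen_ball.is_const_of_deriv_eq_zero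
    (convex_ball (0 : ℂ) R).isPreconnected
    (fun z hz => (key z hz).differentiableAt.differentiableWithinAt)
    (fun z hz => (key z hz).deriv)
  intro z hz
  have := hconst hz h0
  simp only [hg0, neg_zero, Complex.exp_zero, mul_one] at this
  rw [← this, mul_assoc, ← Complex.exp_add]
  simp

noncomputable def alph (b ε : ℕ → ℂ) (k : ℕ) : ℂ :=
  ε k * (b k - ∑ n ∈ k.properDivisors.attach,
    alph b ε n.1 * ((-1) ^ (k / n.1 + 1) * ε n.1 ^ (k / n.1) / ((k / n.1 : ℕ) : ℂ)))
termination_by k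
decreasing_by exact (Nat.mem_properDivisors.1 n.2).2

lemma alph_eq (b ε : ℕ → ℂ) (k : ℕ) : alph b ε k = ε k * (b k - ∑ n ∈ k.properDivisors,
    alph b ε n * ((-1) ^ (k / n + 1) * ε n ^ (k / n) / ((k / n : ℕ) : ℂ))) := by
  rw [alph, Finset.sum_attach k.properDivisors (fun n => alph b ε n *
    ((-1) ^ (k / n + 1) * ε n ^ (k / n) / ((k / n : ℕ) : ℂ)))]

lemma alph_sum (b ε : ℕ → ℂ) (hε : ∀ n ≥ 1, ε n = 1 ∨ ε n = -1) (k : ℕ) (hk : 1 ≤ k) :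
    ∑ n ∈ k.divisors,
      alph b ε n * ((-1) ^ (k / n + 1) * ε n ^ (k / n) / ((k / n : ℕ) : ℂ)) = b k := by
  rw [← Nat.cons_self_properDivisors (by omega : k ≠ 0), Finset.sum_cons, add_comm]
  have h1 : k / k = 1 := Nat.div_self hk
  rw [h1]
  rw [alph_eq b ε k]
  have : ε k * ε k = 1 := by rcases hε k hk with h | h <;> simp [h]
  set S := ∑ n ∈ k.properDivisors,
    alph b ε n * ((-1) ^ (k / n + 1) * ε n ^ (k / n) / ((k / n : ℕ) : ℂ))
  have : ε k * (b k - S) * ((-1) ^ (1 + 1) * ε k ^ 1 / ((1 : ℕ) : ℂ)) = (ε k * ε k) * (b k - S) := by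
    push_cast; ring
  rw [this, ‹ε k * ε k = 1›]; ring

lemma norm_eps (ε : ℕ → ℂ) (hε : ∀ n ≥ 1, ε n = 1 ∨ ε n = -1) (n : ℕ) (hn : 1 ≤ n) :
    ‖ε n‖ = 1 := by rcases hε n hn with h | h <;> simp [h]

lemma norm_coef_le (e : ℂ) (he : ‖e‖ = 1) (m : ℕ) :
    ‖(-1) ^ (m + 1) * e ^ m / (m : ℂ)‖ ≤ 1 := by
  rw [norm_div, norm_mul, norm_pow, norm_pow, he]
  simp only [norm_neg, norm_one, one_pow, mul_one, Complex.norm_natCast, one_div]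
  rcases Nat.eq_zero_or_pos m with h | h
  · simp [h]
  · exact inv_le_one_of_one_le₀ (by exact_mod_cast h)

lemma alph_norm (b ε : ℕ → ℂ) (hε : ∀ n ≥ 1, ε n = 1 ∨ ε n = -1) (k : ℕ) (hk : 1 ≤ k) :
    ‖alph b ε k‖ ≤ ‖b k‖ + ∑ n ∈ k.properDivisors, ‖alph b ε n‖ := by
  rw [alph_eq, norm_mul, norm_eps ε hε k hk, one_mul]
  refine (norm_sub_le _ _).trans (add_le_add_right ((norm_sum_le _ _).trans
    (Finset.sum_le_sum fun n hn => ?_)) _)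
  rw [norm_mul]
  exact mul_le_of_le_one_right (norm_nonneg _)
    (norm_coef_le _ (norm_eps ε hε n (Nat.pos_of_mem_properDivisors hn)) _)

lemma alph_bound (a c : ℕ → ℝ) (ha : ∀ k, 0 ≤ a k)
    (h : ∀ k ≥ 1, a k ≤ c k + ∑ n ∈ k.properDivisors, a n)
    (r : ℝ) (hr0 : 0 < r) (hr1 : r < 1) (C : ℝ) (hC : ∀ k, c k * r ^ k ≤ C) :
    ∃ M, ∀ k, a k * r ^ k ≤ M := by
  obtain ⟨s, hs0, hs1, rfl⟩ : ∃ s : ℝ, 0 < s ∧ s < 1 ∧ r = s ^ 2 :=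
    ⟨√r, Real.sqrt_pos.2 hr0, by rw [Real.sqrt_lt' one_pos]; simpa using hr1,
      (Real.sq_sqrt hr0.le).symm⟩
  have ht := tendsto_self_mul_const_pow_of_lt_one hs0.le hs1
  obtain ⟨k0, hk0⟩ := eventually_atTop.1 (ht.eventually (gt_mem_nhds (show (0 : ℝ) < 1 / 2 by norm_num)))
  set M : ℝ := 2 * |C| + ∑ n ∈ range (k0 + 1), a n * (s ^ 2) ^ n with hM
  have hS : 0 ≤ ∑ n ∈ range (k0 + 1), a n * (s ^ 2) ^ n :=
    Finset.sum_nonneg fun n _ => mul_nonneg (ha n) (by positivity)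
  have hM0 : 0 ≤ M := by positivity
  refine ⟨M, fun k => ?_⟩
  induction k using Nat.strong_induction_on with
  | _ k ih =>
  rcases Nat.lt_or_ge k (k0 + 1) with hk | hk
  · have := Finset.single_le_sum (f := fun n => a n * (s ^ 2) ^ n)
      (fun n _ => mul_nonneg (ha n) (by positivity)) (Finset.mem_range.2 hk)
    have h2 : 0 ≤ 2 * |C| := by positivity
    linarith
  · have h1 := mul_le_mul_of_nonneg_right (h k (by omega)) (show 0 ≤ (s ^ 2) ^ k by positivity)
    rw [add_mul, Finset.sum_mul] at h1
    have h2 : ∑ n ∈ k.properDivisors, a n * (s ^ 2) ^ k ≤ ∑ n ∈ k.properDivisors, M * s ^ k := by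
      refine Finset.sum_le_sum fun n hn => ?_
      obtain ⟨⟨d, hd⟩, hlt⟩ := Nat.mem_properDivisors.1 hn
      have hd2 : 2 * n ≤ k := by
        rw [hd]
        have : 2 ≤ d := by
          by_contra hcon
          have : d = 0 ∨ d = 1 := by omega
          rcases this with rfl | rfl <;> omega
        nlinarith
      have e : a n * (s ^ 2) ^ k = (a n * (s ^ 2) ^ n) * (s ^ 2) ^ (k - n) := by
        rw [mul_assoc, ← pow_add]; congr 2; omega
      rw [e]
      refine mul_le_mul (ih n hlt) ?_ (by positivity) hM0
      rw [← pow_mul]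
      exact pow_le_pow_of_le_one hs0.le hs1.le (by omega)
    rw [Finset.sum_const, nsmul_eq_mul] at h2
    have h3 : (k.properDivisors.card : ℝ) ≤ k := by
      have : k.properDivisors.card ≤ ((Finset.Ico 1 k).card) :=
        Finset.card_le_card (Finset.filter_subset _ _)
      rw [Nat.card_Ico] at this
      exact_mod_cast this.trans (by omega)
    have h4 : (k.properDivisors.card : ℝ) * (M * s ^ k) ≤ M * (1 / 2) := by
      calc _ ≤ (k : ℝ) * (M * s ^ k) := by gcongr
        _ = M * (k * s ^ k) := by ring
        _ ≤ _ := by gcongr; exact (hk0 k (by omega)).le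
    have h5 := (hC k).trans (le_abs_self C)
    linarith

lemma hasSum_logs (a b ε : ℕ → ℂ) (hε : ∀ n ≥ 1, ε n = 1 ∨ ε n = -1)
    (hab : ∀ k ≥ 1, ∑ n ∈ k.divisors,
      a n * ((-1) ^ (k / n + 1) * ε n ^ (k / n) / ((k / n : ℕ) : ℂ)) = b k)
    (x : ℝ) (hx0 : 0 < x) (hx1 : x < 1) (hs : Summable fun n => ‖a n‖ * x ^ n)
    (z : ℂ) (hz : ‖z‖ ≤ x) :
    ∑' i : ℕ, a (i + 1) * Complex.log (1 + ε (i + 1) * z ^ (i + 1))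
      = ∑' i : ℕ, b (i + 1) * z ^ (i + 1) := by
  set F : ℕ+ × ℕ+ → ℂ := fun p =>
    a p.1 * ((-1) ^ ((p.2 : ℕ) + 1) * (ε p.1 * z ^ (p.1 : ℕ)) ^ (p.2 : ℕ) / ((p.2 : ℕ) : ℂ)) with hF
  have hinj : Function.Injective (fun n : ℕ+ => (n : ℕ)) := PNat.coe_injective
  have hsum : Summable F := by
    have h1 : Summable (fun n : ℕ+ => ‖a n‖ * x ^ (n : ℕ)) := hs.comp_injective hinj
    have h2 : Summable (fun n : ℕ+ => x⁻¹ * x ^ (n : ℕ)) :=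
      ((summable_geometric_of_lt_one hx0.le hx1).mul_left _).comp_injective hinj
    have h3 := h1.mul_of_nonneg h2 (fun _ => by positivity) (fun _ => by positivity)
    refine Summable.of_norm_bounded h3 ?_
    rintro ⟨n, m⟩
    have hn := n.pos
    have hm := m.pos
    simp only [hF]
    have e : a n * ((-1) ^ ((m : ℕ) + 1) * (ε n * z ^ (n : ℕ)) ^ (m : ℕ) / ((m : ℕ) : ℂ))
      = a n * (((-1) ^ ((m : ℕ) + 1) * ε n ^ (m : ℕ) / ((m : ℕ) : ℂ)) * z ^ ((n : ℕ) * m)) := by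
      rw [mul_pow, ← pow_mul]; ring
    rw [e, norm_mul, mul_assoc]
    refine mul_le_mul_of_nonneg_left ?_ (norm_nonneg _)
    rw [norm_mul, norm_pow]
    have h4 := norm_coef_le (ε n) (norm_eps ε hε n hn) m
    have h5 : ‖z‖ ^ ((n : ℕ) * m) ≤ x ^ ((n : ℕ) * m) := by gcongr
    have h6 : x ^ ((n : ℕ) * m) ≤ x ^ ((n : ℕ) + m - 1) := by
      apply pow_le_pow_of_le_one hx0.le hx1.le
      have : (n : ℕ) + m ≤ n * m + 1 := by nlinarith
      omega
    have h7 : x ^ ((n : ℕ) + m - 1) = x ^ (n : ℕ) * (x⁻¹ * x ^ (m : ℕ)) := by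
      obtain ⟨d, hd⟩ : ∃ d, (m : ℕ) = d + 1 := ⟨m - 1, by omega⟩
      rw [hd, Nat.add_succ_sub_one, pow_succ, pow_add]
      field_simp
    calc _ ≤ 1 * x ^ ((n : ℕ) * m) := by gcongr
      _ ≤ _ := by rw [one_mul, ← h7]; exact h6
  rw [← tsum_pnat_eq_tsum_succ (f := fun n => a n * Complex.log (1 + ε n * z ^ n)),
    ← tsum_pnat_eq_tsum_succ (f := fun n => b n * z ^ n)]
  have hL : ∑' p, F p = ∑' n : ℕ+, a n * Complex.log (1 + ε n * z ^ (n : ℕ)) := by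
    rw [hsum.tsum_prod]
    refine tsum_congr fun n => ?_
    simp only [hF]
    rw [tsum_mul_left]
    congr 1
    have hw : ‖ε n * z ^ (n : ℕ)‖ < 1 := by
      rw [norm_mul, norm_eps ε hε n n.pos, one_mul, norm_pow]
      exact pow_lt_one₀ (norm_nonneg _) (hz.trans_lt hx1) n.ne_zero
    rw [← (Complex.hasSum_taylorSeries_log hw).tsum_eq,
      tsum_pnat_eq_tsum_succ (f := fun m : ℕ => (-1) ^ (m + 1) * (ε n * z ^ (n : ℕ)) ^ m / (m : ℂ)),
      (Complex.hasSum_taylorSeries_log hw).summable.tsum_eq_zero_add]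
    simp
  rw [← hL, ← sigmaAntidiagonalEquivProd.tsum_eq,
    Summable.tsum_sigma (f := fun c => F (sigmaAntidiagonalEquivProd c))
      (sigmaAntidiagonalEquivProd.summable_iff.2 hsum)]
  refine tsum_congr fun k => ?_
  rw [tsum_fintype, ← hab k k.pos, Finset.sum_mul]
  have h8 := (k : ℕ).divisorsAntidiagonal.sum_attach fun p : ℕ × ℕ =>
    a p.1 * ((-1) ^ ((p.2 : ℕ) + 1) * (ε p.1 * z ^ (p.1 : ℕ)) ^ (p.2 : ℕ) / ((p.2 : ℕ) : ℂ))
  have h9 := Nat.sum_divisorsAntidiagonal (n := k) fun n m : ℕ =>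
    a n * ((-1) ^ (m + 1) * (ε n * z ^ n) ^ m / (m : ℂ))
  refine Eq.trans ?_ (h8.trans (h9.trans (Finset.sum_congr rfl fun n hn => ?_)))
  · rfl
  · rw [mul_pow, ← pow_mul, Nat.mul_div_cancel' (Nat.dvd_of_mem_divisors hn)]; ring

lemma existence (R : ℝ) (hR0 : 0 < R) (hR1 : R ≤ 1)
    (f : ℂ → ℂ) (hf : AnalyticOnNhd ℂ f (Metric.ball (0 : ℂ) R))
    (hfne : ∀ z ∈ Metric.ball (0 : ℂ) R, f z ≠ 0)
    (ε : ℕ → ℂ) (hε : ∀ n ≥ 1, ε n = 1 ∨ ε n = -1) :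
    ∃ α : ℕ → ℂ,
      (∀ K ⊆ Metric.ball (0 : ℂ) R, IsCompact K →
        TendstoUniformlyOn
          (fun N z => f 0 * ∏ n ∈ Finset.Icc 1 N, (1 + ε n * z ^ n) ^ (α n)) f atTop K) := by
  obtain ⟨g, hgd, hg0, hfg⟩ := aux_log R hR0 f hf hfne
  set b : ℕ → ℂ := fun n => ((n.factorial : ℂ))⁻¹ * iteratedDeriv n g 0 with hb
  have hbs : ∀ z ∈ Metric.ball (0 : ℂ) R, HasSum (fun n => b n * z ^ n) (g z) := by
    intro z hz
    have h := Complex.hasSum_taylorSeries_on_ball hgd hz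
    have e : (fun n => b n * z ^ n) =
        fun n : ℕ => ((n.factorial : ℂ))⁻¹ • (z - 0) ^ n • iteratedDeriv n g 0 := by
      funext n
      simp only [hb, sub_zero, smul_eq_mul]; ring
    rw [e]; exact h
  have hb0 : b 0 = 0 := by simp [hb, hg0]
  have hab := alph_sum b ε hε
  have hnorm := alph_norm b ε hε
  generalize alph b ε = a at hab hnorm
  refine ⟨a, fun K hK hKc => ?_⟩
  -- radius
  obtain ⟨x, hx0, hxR, hKx⟩ : ∃ x : ℝ, 0 < x ∧ x < R ∧ ∀ z ∈ K, ‖z‖ ≤ x := by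
    rcases K.eq_empty_or_nonempty with rfl | hne
    · exact ⟨R / 2, by linarith, by linarith, by simp⟩
    · obtain ⟨w, hw, hmax⟩ := hKc.exists_isMaxOn hne continuous_norm.continuousOn
      have : ‖w‖ < R := by simpa using hK hw
      refine ⟨max ‖w‖ (R / 2), lt_max_of_lt_right (by linarith), max_lt this (by linarith), ?_⟩
      intro z hz
      exact le_max_of_le_left (hmax hz)
  have hx1 : x < 1 := by linarith
  obtain ⟨r, hxr, hrR⟩ := exists_between hxR
  have hr0 : 0 < r := hx0.trans hxr
  have hbr := (hbs (r : ℂ) (by simpa [abs_of_pos hr0] using hrR)).summable.norm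
  obtain ⟨M, hM⟩ := alph_bound (fun n => ‖a n‖) (fun n => ‖b n‖) (fun _ => norm_nonneg _) hnorm r hr0
    (by linarith) (∑' n, ‖b n * (r : ℂ) ^ n‖) (fun k => by
      have := hbr.le_tsum k (fun _ _ => norm_nonneg _)
      simpa [norm_mul, norm_pow, abs_of_pos hr0] using this)
  have hs : Summable fun n => ‖a n‖ * x ^ n := by
    refine Summable.of_nonneg_of_le (fun _ => by positivity) (fun n => ?_)
      ((summable_geometric_of_lt_one (r := x / r) (by positivity)
        ((div_lt_one hr0).2 hxr)).mul_left M)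
    have e : ‖a n‖ * x ^ n = (‖a n‖ * r ^ n) * (x / r) ^ n := by
      rw [div_pow]; field_simp
    rw [e]
    exact mul_le_mul_of_nonneg_right (hM n) (by positivity)
  -- uniform convergence of the sums of logarithms
  have hw : ∀ n ≥ 1, ∀ z : ℂ, ‖z‖ ≤ x → ‖ε n * z ^ n‖ ≤ x ^ n := by
    intro n hn z hz
    rw [norm_mul, norm_eps ε hε n hn, one_mul, norm_pow]
    gcongr
  have hxn : ∀ n ≥ 1, x ^ n ≤ x := fun n hn => by
    simpa using pow_le_pow_of_le_one hx0.le hx1.le hn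
  have hU := tendstoUniformlyOn_tsum_nat
    (f := fun i z => a (i + 1) * Complex.log (1 + ε (i + 1) * z ^ (i + 1)))
    (u := fun i => (‖a (i + 1)‖ * x ^ (i + 1)) * (1 + (1 - x)⁻¹)) (s := K)
    (((summable_nat_add_iff 1).2 hs).mul_right _) (by
      intro i z hz
      have h1 := hw (i + 1) (by omega) z (hKx z hz)
      have h2 := hxn (i + 1) (by omega)
      have h3 := Complex.norm_log_one_add_le (z := ε (i + 1) * z ^ (i + 1)) (by linarith)
      rw [norm_mul, mul_assoc]
      refine mul_le_mul_of_nonneg_left (h3.trans ?_) (norm_nonneg _)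
      set t := ‖ε (i + 1) * z ^ (i + 1)‖
      have ht0 : 0 ≤ t := norm_nonneg _
      have h4 : (1 - t)⁻¹ ≤ (1 - x)⁻¹ := by
        apply inv_anti₀ <;> linarith
      have h5 : 0 ≤ (1 - x)⁻¹ := by
        apply inv_nonneg.2; linarith
      have h6 : t ^ 2 ≤ t := by nlinarith
      have h7 : t ^ 2 * (1 - t)⁻¹ ≤ t * (1 - x)⁻¹ := by
        apply mul_le_mul h6 h4 _ ht0
        apply inv_nonneg.2; linarith
      have h8 : t * (1 - x)⁻¹ ≤ x ^ (i + 1) * (1 - x)⁻¹ := mul_le_mul_of_nonneg_right h1 h5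
      have h9 : 0 ≤ t * (1 - x)⁻¹ := mul_nonneg ht0 h5
      rw [mul_add]
      linarith)
  have hlim : ∀ z ∈ K, ∑' i : ℕ, a (i + 1) * Complex.log (1 + ε (i + 1) * z ^ (i + 1)) = g z := by
    intro z hz
    rw [hasSum_logs a b ε hε hab x hx0 hx1 hs z (hKx z hz), ← (hbs z (hK hz)).tsum_eq,
      (hbs z (hK hz)).summable.tsum_eq_zero_add]
    simp [hb0]
  have hU2 := (hU.congr_right hlim).comp_cexp (by
    apply (hKc.image_of_continuousOn _).bddAbove
    exact Complex.continuous_re.comp_continuousOn (hgd.continuousOn.mono hK))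
  have hU3 : TendstoUniformlyOn (fun (N : ℕ) z => f 0 * Complex.exp (∑ i ∈ range N,
      a (i + 1) * Complex.log (1 + ε (i + 1) * z ^ (i + 1)))) (fun z => f 0 * Complex.exp (g z))
      atTop K :=
    (uniformContinuous_const_smul (f 0) : UniformContinuous fun w : ℂ => f 0 • w).comp_tendstoUniformlyOn hU2
  refine (hU3.congr ?_).congr_right fun z hz => (hfg z (hK hz)).symm
  refine Eventually.of_forall fun N z hz => ?_
  simp only
  congr 1
  rw [Complex.exp_sum, Finset.range_eq_Ico,
    Finset.prod_Ico_add' (fun i => Complex.exp (a i * Complex.log (1 + ε i * z ^ i))) 0 N 1]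
  refine Finset.prod_congr (by ext; simp [Nat.lt_succ_iff]) fun n hn => ?_
  have hn1 : 1 ≤ n := by simp at hn; omega
  have hne : 1 + ε n * z ^ n ≠ 0 := by
    intro h0
    have h1 := (hw n hn1 z (hKx z hz)).trans (hxn n hn1)
    rw [← neg_eq_of_add_eq_zero_right h0] at h1
    simp at h1; linarith
  rw [Complex.cpow_def_of_ne_zero hne, mul_comm]


lemma uniq (R : ℝ) (hR0 : 0 < R) (hR1 : R ≤ 1)
    (f : ℂ → ℂ) (hf : AnalyticOnNhd ℂ f (Metric.ball (0 : ℂ) R))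
    (hfne : ∀ z ∈ Metric.ball (0 : ℂ) R, f z ≠ 0)
    (ε : ℕ → ℂ) (hε : ∀ n ≥ 1, ε n = 1 ∨ ε n = -1) (α α' : ℕ → ℂ)
    (hα : ∀ K ⊆ Metric.ball (0 : ℂ) R, IsCompact K →
        TendstoUniformlyOn
          (fun N z => f 0 * ∏ n ∈ Finset.Icc 1 N, (1 + ε n * z ^ n) ^ (α n)) f atTop K)
    (hα' : ∀ K ⊆ Metric.ball (0 : ℂ) R, IsCompact K →
        TendstoUniformlyOn
          (fun N z => f 0 * ∏ n ∈ Finset.Icc 1 N, (1 + ε n * z ^ n) ^ (α' n)) f atTop K) :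
    ∀ n ≥ 1, α' n = α n := by
  have hf0 : f 0 ≠ 0 := hfne 0 (by simpa using hR0)
  have hw : ∀ n ≥ 1, ∀ z ∈ Metric.ball (0 : ℂ) R, ‖ε n * z ^ n‖ < 1 := by
    intro n hn z hz
    rw [norm_mul, norm_eps ε hε n hn, one_mul, norm_pow]
    have : ‖z‖ < R := by simpa using hz
    exact pow_lt_one₀ (norm_nonneg _) (by linarith) (by omega)
  have hslit : ∀ n ≥ 1, ∀ z ∈ Metric.ball (0 : ℂ) R, 1 + ε n * z ^ n ∈ Complex.slitPlane :=
    fun n hn z hz => Complex.mem_slitPlane_of_norm_lt_one (hw n hn z hz)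
  have hne : ∀ n ≥ 1, ∀ z ∈ Metric.ball (0 : ℂ) R, 1 + ε n * z ^ n ≠ 0 :=
    fun n hn z hz => Complex.slitPlane_ne_zero (hslit n hn z hz)
  have hder : ∀ (β : ℕ → ℂ), ∀ n ≥ 1, ∀ z ∈ Metric.ball (0 : ℂ) R,
      HasDerivAt (fun z => (1 + ε n * z ^ n) ^ (β n))
        (β n * (1 + ε n * z ^ n) ^ (β n - 1) * (ε n * (n * z ^ (n - 1)))) z := by
    intro β n hn z hz
    exact (((hasDerivAt_pow n z).const_mul (ε n)).const_add 1).cpow_const (hslit n hn z hz)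
  have hld : ∀ (β : ℕ → ℂ) (N : ℕ), ∀ z ∈ Metric.ball (0 : ℂ) R,
      logDeriv (fun z => f 0 * ∏ n ∈ Finset.Icc 1 N, (1 + ε n * z ^ n) ^ (β n)) z
        = ∑ n ∈ Finset.Icc 1 N, β n * (ε n * (n * z ^ (n - 1)) / (1 + ε n * z ^ n)) := by
    intro β N z hz
    rw [logDeriv_const_mul z (f 0) hf0, logDeriv_prod]
    · refine Finset.sum_congr rfl fun n hn => ?_
      have hn1 := (Finset.mem_Icc.1 hn).1
      have h1 := hne n hn1 z hz
      rw [logDeriv_apply, (hder β n hn1 z hz).deriv, Complex.cpow_sub _ _ h1, Complex.cpow_one]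
      have h2 : (1 + ε n * z ^ n) ^ (β n) ≠ 0 := by simp [Complex.cpow_eq_zero_iff, h1]
      field_simp
    · intro n hn
      simp [Complex.cpow_eq_zero_iff, hne n (Finset.mem_Icc.1 hn).1 z hz]
    · intro n hn
      exact (hder β n (Finset.mem_Icc.1 hn).1 z hz).differentiableAt
  have hlim : ∀ β : ℕ → ℂ, (∀ K ⊆ Metric.ball (0 : ℂ) R, IsCompact K →
        TendstoUniformlyOn
          (fun N z => f 0 * ∏ n ∈ Finset.Icc 1 N, (1 + ε n * z ^ n) ^ (β n)) f atTop K) →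
      TendstoUniformlyOn (fun (N : ℕ) z => ∑ n ∈ Finset.Icc 1 N,
        β n * (ε n * (n * z ^ (n - 1)) / (1 + ε n * z ^ n))) (logDeriv f) atTop
        (Metric.sphere 0 (R / 2)) := by
    intro β hβ
    have h1 := (tendstoLocallyUniformlyOn_iff_forall_isCompact Metric.isOpen_ball).2 hβ
    have h2 := h1.deriv (Eventually.of_forall fun N => by
      intro z hz
      refine DifferentiableAt.differentiableWithinAt ?_
      refine DifferentiableAt.const_mul ?_ _
      refine DifferentiableAt.fun_finsetProd fun n hn => ?_
      exact (hder β n (Finset.mem_Icc.1 hn).1 z hz).differentiableAt) Metric.isOpen_ball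
    have h3 := h2.div₀ h1 hf.deriv.continuousOn hf.continuousOn hfne
    have hsub : Metric.sphere (0 : ℂ) (R / 2) ⊆ Metric.ball 0 R := by
      intro z hz
      have : ‖z‖ = R / 2 := by simpa using hz
      simp [this]; linarith
    have h4 := (tendstoLocallyUniformlyOn_iff_forall_isCompact Metric.isOpen_ball).1 h3 _ hsub
      (isCompact_sphere 0 (R / 2))
    exact h4.congr (Eventually.of_forall fun N z hz => hld β N z (hsub hz))
  have hdiff := (hlim α' hα').sub (hlim α hα)
  intro k
  induction k using Nat.strong_induction_on with
  | _ k ih =>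
  intro hk
  by_contra hcon
  set γ : ℂ := (α' k - α k) * (ε k * k) with hγ
  have hγ0 : γ ≠ 0 := by
    refine mul_ne_zero (sub_ne_zero.2 hcon) (mul_ne_zero ?_ (by exact_mod_cast (by omega : k ≠ 0)))
    intro h; have := norm_eps ε hε k hk; simp [h] at this
  set ρ : ℝ := R / 2 with hρ
  have hρ0 : 0 < ρ := by positivity
  have hev := Metric.tendstoUniformlyOn_iff.1 hdiff (‖γ‖ / 2 * ρ ^ (k - 1)) (by positivity)
  obtain ⟨N, hN, hNk⟩ := (hev.and (eventually_ge_atTop k)).exists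
  set E : ℂ → ℂ := fun z => ∑ n ∈ Finset.Icc k N,
    (α' n - α n) * (ε n * (n * z ^ (n - k)) / (1 + ε n * z ^ n)) with hE
  have hEd : DifferentiableOn ℂ E (Metric.ball 0 R) := by
    refine DifferentiableOn.fun_sum fun n hn => ?_
    have hn1 : 1 ≤ n := hk.trans (Finset.mem_Icc.1 hn).1
    refine DifferentiableOn.const_mul (DifferentiableOn.fun_div (by fun_prop) (by fun_prop)
      (hne n hn1)) _
  have hsub : Metric.closedBall (0 : ℂ) ρ ⊆ Metric.ball 0 R :=
    Metric.closedBall_subset_ball (by linarith)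
  have hE0 : E 0 = γ := by
    simp only [hE]
    rw [Finset.sum_eq_single_of_mem k (Finset.mem_Icc.2 ⟨le_rfl, hNk⟩)]
    · rw [zero_pow (by omega : k ≠ 0)]; simp [hγ]
    · intro n hn hnk
      have : n - k ≠ 0 := by have := (Finset.mem_Icc.1 hn).1; omega
      simp [this]
  have hbd : ‖E 0‖ ≤ ‖γ‖ / 2 := by
    refine Complex.norm_le_of_forall_mem_frontier_norm_le (U := Metric.ball (0 : ℂ) ρ)
      Metric.isBounded_ball ((hEd.mono hsub).diffContOnCl_ball subset_rfl) ?_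
      (subset_closure (by simpa using hρ0))
    intro z hz
    rw [frontier_ball _ hρ0.ne'] at hz
    have hzn : ‖z‖ = ρ := by simpa using hz
    have h1 := hN z hz
    have h2 : (∑ n ∈ Finset.Icc 1 N, α' n * (ε n * (n * z ^ (n - 1)) / (1 + ε n * z ^ n)))
      - (∑ n ∈ Finset.Icc 1 N, α n * (ε n * (n * z ^ (n - 1)) / (1 + ε n * z ^ n)))
      = z ^ (k - 1) * E z := by
      rw [← Finset.sum_sub_distrib, hE, Finset.mul_sum]
      rw [← Finset.sum_subset (Finset.Icc_subset_Icc_left hk)]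
      · refine Finset.sum_congr rfl fun n hn => ?_
        have : z ^ (n - 1) = z ^ (k - 1) * z ^ (n - k) := by
          rw [← pow_add]; congr 1; have := (Finset.mem_Icc.1 hn).1; omega
        rw [this]; ring
      · intro n hn hn2
        rw [Finset.mem_Icc] at hn hn2
        rw [ih n (by omega) hn.1]; ring
    simp only [Pi.sub_apply, sub_self] at h1
    rw [h2, dist_zero_left, norm_mul, norm_pow, hzn, mul_comm] at h1
    exact (lt_of_mul_lt_mul_right h1 (by positivity)).le
  rw [hE0] at hbd
  have : 0 < ‖γ‖ := norm_pos_iff.2 hγ0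
  linarith

theorem stmt_10 (R : ℝ) (hR0 : 0 < R) (hR1 : R ≤ 1)
    (f : ℂ → ℂ) (hf : AnalyticOnNhd ℂ f (Metric.ball (0 : ℂ) R))
    (hfne : ∀ z ∈ Metric.ball (0 : ℂ) R, f z ≠ 0)
    (ε : ℕ → ℂ) (hε : ∀ n ≥ 1, ε n = 1 ∨ ε n = -1) :
    ∃ α : ℕ → ℂ,
      (∀ K ⊆ Metric.ball (0 : ℂ) R, IsCompact K →
        TendstoUniformlyOn
          (fun N z => f 0 * ∏ n ∈ Finset.Icc 1 N, (1 + ε n * z ^ n) ^ (α n)) f atTop K)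
      ∧ ∀ α' : ℕ → ℂ,
          (∀ K ⊆ Metric.ball (0 : ℂ) R, IsCompact K →
            TendstoUniformlyOn
              (fun N z => f 0 * ∏ n ∈ Finset.Icc 1 N, (1 + ε n * z ^ n) ^ (α' n)) f atTop K) →
          ∀ n ≥ 1, α' n = α n := by
  obtain ⟨α, hα⟩ := existence R hR0 hR1 f hf hfne ε hε
  exact ⟨α, hα, fun α' hα' => uniq R hR0 hR1 f hf hfne ε hε α α' hα hα'⟩
end

section
/- Let A be a k×k matrix with integer entries, let p be a prime number, and let m be a positive integer. Then tr(A^{p^m}) ≡ tr(A^{p^{m−1}}) (mod p^m), where tr denotes the trace of a matrix. -/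
open Polynomial in
lemma det_aeval_roots {k : ℕ} (A : Matrix (Fin k) (Fin k) ℂ) (f : ℂ[X]) :
    (aeval A f).det = (A.charpoly.roots.map (fun x => f.eval x)).prod := by
  have hs : A.charpoly.Splits := IsAlgClosed.splits _
  have hcard : A.charpoly.roots.card = k := by
    rw [← hs.natDegree_eq_card_roots, Matrix.charpoly_natDegree_eq_dim, Fintype.card_fin]
  have hC : ∀ c : ℂ, (aeval A (C c)).det = (A.charpoly.roots.map (fun x => (C c).eval x)).prod := by
    intro c
    simp [hcard, Algebra.algebraMap_eq_smul_one, Matrix.det_smul]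
  have hmul : ∀ f g : ℂ[X], (aeval A f).det = (A.charpoly.roots.map (fun x => f.eval x)).prod →
      (aeval A g).det = (A.charpoly.roots.map (fun x => g.eval x)).prod →
      (aeval A (f * g)).det = (A.charpoly.roots.map (fun x => (f * g).eval x)).prod := by
    intro f g hf hg
    simp only [map_mul, Matrix.det_mul, hf, hg, eval_mul, Multiset.prod_map_mul]
  have hX : ∀ r : ℂ, (aeval A (C r - X)).det
      = (A.charpoly.roots.map (fun x => (C r - X).eval x)).prod := by
    intro r
    have h := hs.eval_eq_prod_roots_of_monic A.charpoly_monic r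
    rw [Matrix.eval_charpoly] at h
    simpa [Matrix.algebraMap_eq_diagonal, Matrix.scalar_apply, Pi.algebraMap_def] using h
  have hX' : ∀ r : ℂ, (aeval A (X - C r)).det
      = (A.charpoly.roots.map (fun x => (X - C r).eval x)).prod := by
    intro r
    have : (X - C r : ℂ[X]) = C (-1) * (C r - X) := by simp
    rw [this]
    exact hmul _ _ (hC _) (hX _)
  rw [(IsAlgClosed.splits f).eq_prod_roots]
  apply hmul _ _ (hC _)
  generalize f.roots = s
  induction s using Multiset.induction_on with
  | empty => simp
  | cons a s ih =>
    rw [Multiset.map_cons, Multiset.prod_cons]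
    exact hmul _ _ (hX' a) ih

open Polynomial in
lemma trace_pow_roots {k : ℕ} (A : Matrix (Fin k) (Fin k) ℂ) (n : ℕ) :
    (A ^ n).trace = (A.charpoly.roots.map (fun x => x ^ n)).sum := by
  have h : (A ^ n).charpoly = ((A.charpoly.roots.map (fun x => x ^ n)).map (fun a => X - C a)).prod := by
    apply Polynomial.funext
    intro r
    have h := det_aeval_roots A (C r - X ^ n)
    rw [Matrix.eval_charpoly, eval_multiset_prod]
    simpa [Matrix.algebraMap_eq_diagonal, Matrix.scalar_apply, Pi.algebraMap_def,
      Function.comp_def] using h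
  rw [Matrix.trace_eq_sum_roots_charpoly, h, roots_multiset_prod_X_sub_C]

lemma int_pow_sub (p : ℕ) (hp : p.Prime) (a : ℤ) (j : ℕ) :
    (p : ℤ) ^ (j + 1) ∣ a ^ p ^ (j + 1) - a ^ p ^ j := by
  haveI := Fact.mk hp
  have h : (p : ℤ) ∣ a ^ p - a := by
    rw [← ZMod.intCast_zmod_eq_zero_iff_dvd]
    simp
  have := dvd_sub_pow_of_dvd_sub h j
  rwa [← pow_mul, ← pow_succ'] at this

lemma int_of_integral (x : ℂ) (hx : IsIntegral ℤ x) (c : ℤ) (d : ℕ) (hd : d ≠ 0)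
    (h : (d : ℂ) * x = c) : ∃ a : ℤ, x = a := by
  have hx' : x = algebraMap ℚ ℂ ((c : ℚ) / d) := by
    have : (d : ℂ) ≠ 0 := by exact_mod_cast hd
    simp
    field_simp
    rw [← h]; ring
  rw [hx'] at hx
  rw [isIntegral_algebraMap_iff (algebraMap ℚ ℂ).injective] at hx
  obtain ⟨a, ha⟩ := IsIntegrallyClosed.isIntegral_iff.mp hx
  refine ⟨a, ?_⟩
  rw [hx', ← ha]
  simp

lemma ghost_ints (k : ℕ) (A : Matrix (Fin k) (Fin k) ℤ) (p : ℕ) (hp : p.Prime) :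
    ∃ a : ℕ → ℤ, ∀ n, (A ^ p ^ n).trace
      = ∑ i ∈ Finset.range (n + 1), (p : ℤ) ^ i * a i ^ p ^ (n - i) := by
  haveI := Fact.mk hp
  let B : Matrix (Fin k) (Fin k) ℂ := A.map (Int.castRingHom ℂ)
  have hB : ∀ n, (B ^ n).trace = (((A ^ n).trace : ℤ) : ℂ) := by
    intro n
    have : B ^ n = (A ^ n).map (Int.castRingHom ℂ) := by
      simp only [B]
      exact ((Int.castRingHom ℂ).mapMatrix.map_pow A n).symm
    rw [this]
    simp [Matrix.trace]
  have hint : ∀ x ∈ B.charpoly.roots, x ∈ integralClosure ℤ ℂ := by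
    intro x hx
    refine ⟨A.charpoly, A.charpoly_monic, ?_⟩
    have h2 := Polynomial.isRoot_of_mem_roots hx
    simp only [B, Matrix.charpoly_map] at h2
    rw [Polynomial.IsRoot, Polynomial.eval_map] at h2
    exact h2
  let R := integralClosure ℤ ℂ
  obtain ⟨s, hs⟩ : ∃ s : Multiset R, s.map (fun x : R => (x : ℂ)) = B.charpoly.roots := by
    have := CanLift.prf (self := Multiset.canLift (fun x : R => (x : ℂ)) (fun x => x ∈ R))
      B.charpoly.roots hint
    exact this
  let w : WittVector p R := (s.map (WittVector.teichmuller p)).sum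
  have hw : ∀ n, (((A ^ p ^ n).trace : ℤ) : ℂ)
      = ∑ i ∈ Finset.range (n + 1), (p : ℂ) ^ i * (w.coeff i : ℂ) ^ p ^ (n - i) := by
    intro n
    have h1 : WittVector.ghostComponent n w = (s.map (fun x => x ^ p ^ n)).sum := by
      simp only [w, map_multiset_sum, Multiset.map_map, Function.comp_def,
        WittVector.ghostComponent_teichmuller]
    rw [WittVector.ghostComponent_apply, aeval_wittPolynomial] at h1
    have h2 := congrArg (algebraMap R ℂ) h1
    rw [← hB, trace_pow_roots, ← hs, Multiset.map_map]
    rw [map_multiset_sum, Multiset.map_map, map_sum] at h2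
    simp only [Function.comp_def, map_mul, map_pow, map_natCast] at h2
    exact h2.symm
  have ha : ∀ n, ∃ a : ℤ, (w.coeff n : ℂ) = a := by
    intro n
    induction n using Nat.strong_induction_on with
    | _ n ih =>
      choose! b hb using ih
      refine int_of_integral _ (w.coeff n).2 ((A ^ p ^ n).trace
        - ∑ i ∈ Finset.range n, (p : ℤ) ^ i * b i ^ p ^ (n - i)) (p ^ n)
        (pow_ne_zero _ hp.ne_zero) ?_
      have h := hw n
      rw [Finset.sum_range_succ] at h
      push_cast
      rw [h, Finset.sum_congr rfl (fun i hi => by rw [hb i (Finset.mem_range.mp hi)])]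
      simp
  choose a ha using ha
  refine ⟨a, fun n => ?_⟩
  have h := hw n
  simp only [ha] at h
  exact_mod_cast h

theorem stmt_17 (k : ℕ) (A : Matrix (Fin k) (Fin k) ℤ) (p : ℕ) (hp : p.Prime)
    (m : ℕ) (hm : 1 ≤ m) :
    ((A ^ p ^ m).trace : ℤ) ≡ (A ^ p ^ (m - 1)).trace [ZMOD (p : ℤ) ^ m] := by
  obtain ⟨a, ha⟩ := ghost_ints k A p hp
  obtain ⟨n, rfl⟩ : ∃ n, m = n + 1 := ⟨m - 1, by omega⟩
  symm
  rw [Int.modEq_iff_dvd, Nat.add_sub_cancel, ha, ha, Finset.sum_range_succ _ (n + 1),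
    add_sub_right_comm, ← Finset.sum_sub_distrib]
  refine dvd_add (Finset.dvd_sum fun i hi => ?_) (Dvd.intro _ rfl)
  have hi' : i ≤ n := by simpa [Nat.lt_succ_iff] using hi
  obtain ⟨j, rfl⟩ := Nat.exists_eq_add_of_le hi'
  have e1 : i + j + 1 - i = j + 1 := by omega
  have e2 : i + j - i = j := by omega
  rw [e1, e2, ← mul_sub, add_assoc, pow_add]
  exact mul_dvd_mul_left _ (int_pow_sub p hp _ _)
end
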